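/- Let u ∈ ℝ^{2n+1} be a unit vector with u ∉ ℝe₁, and set α := u·e₁ (so |α| < 1). Then the plane Π_u := span{e₁, u} is closed under the Vidinli multiplication, and for a = a₁e₁ + a₂u, b = b₁e₁ + b₂u one has a ∗ b = (a₁b₁ − a₂b₂) e₁ + (a₁b₂ + a₂b₁ + 2α a₂b₂) u. Moreover the linear map Π_u → ℂ sending e₁ ↦ 1 and u ↦ η, where η := α + i√(1 − α²), is a bijective ℝ-linear map satisfying φ(a ∗ b) = φ(a)·φ(b); hence (Π_u, ∗) is isomorphic to ℂ as a real algebra. -/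

import Mathlib

noncomputable section

/-- Standard dot product on `ℝ^m`. -/
def dot {m : ℕ} (a b : Fin m → ℝ) : ℝ := ∑ i, a i * b i

/-- The distinguished unit vector `e₁` of the Vidinli algebra (index `0`). -/
def e1 (n : ℕ) : Fin (2*n+1) → ℝ := fun i => if i.val = 0 then 1 else 0

/-- The standard symplectic form `ω` on `ℝ^{2n+1}` (vanishing on `e₁`):
`ω(a,b) = Σ_{k=1}^n (a_{2k} b_{2k+1} − a_{2k+1} b_{2k})` in the paper's 1-based indexing. -/
def omg (n : ℕ) (a b : Fin (2*n+1) → ℝ) : ℝ :=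
  ∑ k : Fin n,
    (a ⟨2*k.val+1, by have := k.isLt; omega⟩ * b ⟨2*k.val+2, by have := k.isLt; omega⟩
   - a ⟨2*k.val+2, by have := k.isLt; omega⟩ * b ⟨2*k.val+1, by have := k.isLt; omega⟩)

/-- The Vidinli multiplication on `ℝ^{2n+1}`. -/
def vprod (n : ℕ) (a b : Fin (2*n+1) → ℝ) : Fin (2*n+1) → ℝ :=
  dot a (e1 n) • b + dot b (e1 n) • a - dot a b • e1 n + omg n a b • e1 n

theorem dot_comm {m : ℕ} (a b : Fin m → ℝ) : dot a b = dot b a := by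
  simp only [dot, mul_comm]

theorem dot_add_left {m : ℕ} (a b c : Fin m → ℝ) : dot (a + b) c = dot a c + dot b c :=
  add_dotProduct a b c

theorem dot_smul_left {m : ℕ} (r : ℝ) (a c : Fin m → ℝ) : dot (r • a) c = r * dot a c :=
  smul_dotProduct r a c

theorem dot_add_right {m : ℕ} (a b c : Fin m → ℝ) : dot a (b + c) = dot a b + dot a c :=
  dotProduct_add a b c

theorem dot_smul_right {m : ℕ} (r : ℝ) (a c : Fin m → ℝ) : dot a (r • c) = r * dot a c :=
  dotProduct_smul r a c

theorem dot_e1_e1 (n : ℕ) : dot (e1 n) (e1 n) = 1 := by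
  rw [dot, Fin.sum_univ_succ]
  simp [e1]

theorem omg_span_e1 (n : ℕ) (u : Fin (2*n+1) → ℝ) (a₁ a₂ b₁ b₂ : ℝ) :
    omg n (a₁ • e1 n + a₂ • u) (b₁ • e1 n + b₂ • u) = 0 := by
  refine Finset.sum_eq_zero fun k _ => ?_
  simp only [e1, Pi.add_apply, Pi.smul_apply, smul_eq_mul, Nat.add_eq_zero_iff, one_ne_zero,
    OfNat.ofNat_ne_zero, and_false, if_false]
  ring

/-- The Vidinli product on the plane spanned by `e₁` and a unit vector. -/
theorem vprod_span_e1 (n : ℕ) (u : Fin (2*n+1) → ℝ) (hu : dot u u = 1) (a₁ a₂ b₁ b₂ : ℝ) :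
    vprod n (a₁ • e1 n + a₂ • u) (b₁ • e1 n + b₂ • u)
      = (a₁*b₁ - a₂*b₂) • e1 n
        + (a₁*b₂ + a₂*b₁ + 2*(dot u (e1 n))*a₂*b₂) • u := by
  rw [vprod, omg_span_e1]
  simp only [dot_add_left, dot_smul_left, dot_add_right, dot_smul_right, dot_e1_e1, hu,
    dot_comm (e1 n) u]
  module

/-- A unit vector off the line `ℝe₁` satisfies `|u·e₁| < 1`. -/
theorem dot_e1_sq_lt_one (n : ℕ) (u : Fin (2*n+1) → ℝ) (hu1 : dot u u = 1)
    (hu2 : ∀ c : ℝ, u ≠ c • e1 n) : 0 < 1 - dot u (e1 n) ^ 2 := by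
  have key : dot (u + (-dot u (e1 n)) • e1 n) (u + (-dot u (e1 n)) • e1 n)
      = 1 - dot u (e1 n) ^ 2 := by
    simp only [dot_add_left, dot_smul_left, dot_add_right, dot_smul_right, dot_e1_e1, hu1,
      dot_comm (e1 n) u]
    ring
  rw [← key]
  refine lt_of_le_of_ne (Finset.sum_nonneg fun i _ => mul_self_nonneg _) fun h => ?_
  have h0 := dotProduct_self_eq_zero.1 h.symm
  apply hu2 (dot u (e1 n))
  rw [neg_smul, ← sub_eq_add_neg] at h0
  exact sub_eq_zero.1 h0

/-- The linear map with real part `x·e₁` and imaginary part the component of `x` along the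
normalization of `u - (u·e₁)e₁`. -/
def planeToComplex (n : ℕ) (u : Fin (2*n+1) → ℝ) : (Fin (2*n+1) → ℝ) →ₗ[ℝ] ℂ where
  toFun x := ⟨dot x (e1 n),
    (dot x u - dot u (e1 n) * dot x (e1 n)) / Real.sqrt (1 - dot u (e1 n) ^ 2)⟩
  map_add' x y := by
    apply Complex.ext <;> simp only [dot_add_left, Complex.add_re, Complex.add_im]
    ring
  map_smul' r x := by
    apply Complex.ext <;>
      simp only [dot_smul_left, Complex.smul_re, Complex.smul_im, smul_eq_mul, RingHom.id_apply]
    ring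

theorem planeToComplex_apply (n : ℕ) (u : Fin (2*n+1) → ℝ) (hu1 : dot u u = 1)
    (hu2 : ∀ c : ℝ, u ≠ c • e1 n) (a b : ℝ) :
    planeToComplex n u (a • e1 n + b • u)
      = ⟨a + b * dot u (e1 n), b * Real.sqrt (1 - dot u (e1 n) ^ 2)⟩ := by
  have h := dot_e1_sq_lt_one n u hu1 hu2
  have hs := Real.sqrt_pos.2 h
  apply Complex.ext
  · simp [planeToComplex, dot_add_left, dot_smul_left, dot_e1_e1]
  · simp only [planeToComplex, LinearMap.coe_mk, AddHom.coe_mk, dot_add_left, dot_smul_left,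
      dot_e1_e1, hu1, dot_comm (e1 n) u]
    rw [div_eq_iff hs.ne', mul_assoc, Real.mul_self_sqrt h.le]
    ring

/-- For a unit vector `u ∉ ℝe₁` with `α = u·e₁`, the plane
`Π_u = span{e₁, u}` is closed under the Vidinli multiplication, the product has
the stated coordinate formula, and `Π_u` is isomorphic to `ℂ` as a real algebra
via `e₁ ↦ 1`, `u ↦ α + i√(1 − α²)`. -/
theorem vidinli_principal_plane_complex (n : ℕ) (hn : 1 ≤ n)
    (u : Fin (2*n+1) → ℝ) (hu1 : dot u u = 1) (hu2 : ∀ c : ℝ, u ≠ c • e1 n) :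
    (∀ x ∈ Submodule.span ℝ {e1 n, u}, ∀ y ∈ Submodule.span ℝ {e1 n, u},
        vprod n x y ∈ Submodule.span ℝ {e1 n, u}) ∧
    (∀ a₁ a₂ b₁ b₂ : ℝ,
        vprod n (a₁ • e1 n + a₂ • u) (b₁ • e1 n + b₂ • u)
          = (a₁*b₁ - a₂*b₂) • e1 n
            + (a₁*b₂ + a₂*b₁ + 2*(dot u (e1 n))*a₂*b₂) • u) ∧
    (∃ φ : ↥(Submodule.span ℝ {e1 n, u}) →ₗ[ℝ] ℂ,
        Function.Bijective φ ∧
        φ ⟨e1 n, Submodule.subset_span (by simp)⟩ = 1 ∧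
        φ ⟨u, Submodule.subset_span (by simp)⟩
          = (dot u (e1 n) : ℂ) + Real.sqrt (1 - (dot u (e1 n))^2) * Complex.I ∧
        ∀ x y : ↥(Submodule.span ℝ {e1 n, u}),
          ∀ h : vprod n x.1 y.1 ∈ Submodule.span ℝ {e1 n, u},
            φ ⟨vprod n x.1 y.1, h⟩ = φ x * φ y) := by
  have hprod := vprod_span_e1 n u hu1
  have hφ := planeToComplex_apply n u hu1 hu2
  have hpos := dot_e1_sq_lt_one n u hu1 hu2
  have hs := Real.sqrt_pos.2 hpos
  have hsq := Real.mul_self_sqrt hpos.le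
  refine ⟨fun x hx y hy => ?_, hprod, (planeToComplex n u).domRestrict _, ⟨?_, ?_⟩, ?_, ?_, ?_⟩
  · obtain ⟨a₁, a₂, rfl⟩ := Submodule.mem_span_pair.1 hx
    obtain ⟨b₁, b₂, rfl⟩ := Submodule.mem_span_pair.1 hy
    rw [hprod]
    exact Submodule.mem_span_pair.2 ⟨_, _, rfl⟩
  · refine (injective_iff_map_eq_zero _).2 ?_
    rintro ⟨x, hx⟩ h
    obtain ⟨a, b, rfl⟩ := Submodule.mem_span_pair.1 hx
    rw [LinearMap.domRestrict_apply, hφ, Complex.ext_iff] at h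
    obtain ⟨hre, him⟩ := h
    have hb : b = 0 := (mul_eq_zero.1 him).resolve_right hs.ne'
    have ha : a = 0 := by simpa [hb] using hre
    simp [ha, hb]
  · intro z
    refine ⟨⟨(z.re - z.im / Real.sqrt (1 - dot u (e1 n) ^ 2) * dot u (e1 n)) • e1 n
      + (z.im / Real.sqrt (1 - dot u (e1 n) ^ 2)) • u,
      Submodule.mem_span_pair.2 ⟨_, _, rfl⟩⟩, ?_⟩
    rw [LinearMap.domRestrict_apply, hφ]
    apply Complex.ext
    · simp
    · exact div_mul_cancel₀ _ hs.ne'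
  · have h := hφ 1 0
    rw [one_smul, zero_smul, add_zero] at h
    rw [LinearMap.domRestrict_apply, h]
    apply Complex.ext <;> simp
  · have h := hφ 0 1
    rw [one_smul, zero_smul, zero_add] at h
    rw [LinearMap.domRestrict_apply, h]
    apply Complex.ext <;> simp
  · rintro ⟨x, hx⟩ ⟨y, hy⟩ h
    obtain ⟨a₁, a₂, rfl⟩ := Submodule.mem_span_pair.1 hx
    obtain ⟨b₁, b₂, rfl⟩ := Submodule.mem_span_pair.1 hy
    simp only [LinearMap.domRestrict_apply, hprod, hφ]
    apply Complex.ext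
    · simp only [Complex.mul_re]
      linear_combination a₂ * b₂ * hsq
    · simp only [Complex.mul_im]
      ring
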